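/- (Theorem 2, Upper Bound of QFI for partial perturbation.) Consider N particles with local Hilbert spaces ℂ^{d_1},…,ℂ^{d_N}. The first N_B ≤ N particles each carry a Hermitian local operator O_i on ℂ^{d_i} with spectral width Δ_i = λ_max(O_i) − λ_min(O_i), relabeled so that Δ_1 ≥ ⋯ ≥ Δ_{N_B} > 0; the remaining N − N_B particles are unperturbed. Let O_B = Σ_{i=1}^{N_B} Õ_i, where Õ_i acts as O_i on slot i of the total space and trivially elsewhere. If the density matrix ρ on the total space is k-producible for some k ≤ N_B, then F_Q[ρ,O_B] ≤ F_B(k;{Δ_i}) := Σ_{l=0}^{q_B−1} (Σ_{j=1}^k Δ_{kl+j})² + (Σ_{j=1}^{r_B} Δ_{kq_B+j})², where q_B = ⌊N_B/k⌋ and r_B = N_B − kq_B. -/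

import Mathlib

open Matrix

/-- Quantum Fisher information of a density matrix given by its eigenvalues `p`
and orthonormal eigenbasis `e`, with respect to the operator `O`. -/
noncomputable def QFI {ι : Type*} [Fintype ι] (p : ι → ℝ) (e : ι → ι → ℂ)
    (O : Matrix ι ι ℂ) : ℝ :=
  2 * ∑ l, ∑ l', if 0 < p l + p l' then
    (p l - p l') ^ 2 / (p l + p l') * Complex.normSq (star (e l) ⬝ᵥ O.mulVec (e l'))
  else 0

/-- The operator acting as `A` on the `i`-th tensor factor and as the identity on
all other factors, as a matrix on the product index set `Π j, Fin (d j)`. -/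
noncomputable def localOp {N : ℕ} {d : Fin N → ℕ} (i : Fin N)
    (A : Matrix (Fin (d i)) (Fin (d i)) ℂ) :
    Matrix (∀ j, Fin (d j)) (∀ j, Fin (d j)) ℂ :=
  fun x y => A (x i) (y i) * (if ∀ j, j ≠ i → x j = y j then 1 else 0)

/-- A pure state `Ψ` on the product index set is `k`-producible if it factorizes
over some partition of the `N` particles (encoded as the fibers of a coloring
`c : Fin N → Fin M`) whose blocks all have cardinality at most `k`. -/
def Producible {N : ℕ} (d : Fin N → ℕ) (k : ℕ) (Ψ : (∀ i, Fin (d i)) → ℂ) : Prop :=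
  ∃ (M : ℕ) (c : Fin N → Fin M),
    (∀ m, (Finset.univ.filter (fun i => c i = m)).card ≤ k) ∧
    ∃ φ : ∀ m : Fin M, ((∀ i : {i : Fin N // c i = m}, Fin (d i.val)) → ℂ),
      ∀ x, Ψ x = ∏ m, φ m (fun i => x i.val)

/-- The QFI upper-bound function for `N_B` perturbed particles:
`F_B(k;{Δ}) = Σ_{l=0}^{q_B−1} (Σ_{j=1}^k Δ_{kl+j})² + (Σ_{j=1}^{r_B} Δ_{kq_B+j})²`
with `q_B = ⌊N_B/k⌋`, `r_B = N_B − kq_B` (0-based indices: `Δ 0` is `Δ_1`). -/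
noncomputable def Fbound (NB k : ℕ) (Δ : ℕ → ℝ) : ℝ :=
  (∑ l ∈ Finset.range (NB / k), (∑ j ∈ Finset.range k, Δ (k * l + j)) ^ 2)
    + (∑ j ∈ Finset.range (NB % k), Δ (k * (NB / k) + j)) ^ 2


lemma sumsq_le_aux {ι : Type*} [DecidableEq ι] (w : ι → ℝ) (v : ℕ → ℝ) (s : Finset ι)
    (h : ∀ T : Finset ι, T ⊆ s → ∑ m ∈ T, w m ≤ ∑ l ∈ Finset.range T.card, v l) :
    ∀ θ : ℝ, (∀ m ∈ s, θ ≤ w m) → 2 * θ * (∑ l ∈ Finset.range s.card, v l - ∑ m ∈ s, w m) ≤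
      ∑ l ∈ Finset.range s.card, v l ^ 2 - ∑ m ∈ s, w m ^ 2 := by
  revert h
  induction s using Finset.induction_on_min_value w with
  | empty => simp
  | insert a s ha hmin ih =>
    intro h θ hθ
    have ih' := ih (fun T hT => h T (hT.trans (Finset.subset_insert _ _))) (w a) hmin
    have hP := h _ (Finset.Subset.refl _)
    have h1 := hθ a (Finset.mem_insert_self _ _)
    rw [Finset.card_insert_of_notMem ha, Finset.sum_range_succ, Finset.sum_insert ha] at *
    rw [Finset.sum_range_succ, Finset.sum_insert ha]
    nlinarith [sq_nonneg (v s.card - w a), mul_nonneg (sub_nonneg.2 h1) (sub_nonneg.2 hP)]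

lemma sum_le_range (f : ℕ → ℝ) (hf : Antitone f) (A : Finset ℕ) :
    ∑ i ∈ A, f i ≤ ∑ i ∈ Finset.range A.card, f i := by
  induction A using Finset.induction_on_max with
  | empty => simp
  | insert a s hmax ih =>
    have ha : a ∉ s := fun h => lt_irrefl _ (hmax a h)
    rw [Finset.card_insert_of_notMem ha, Finset.sum_range_succ, Finset.sum_insert ha]
    have : s.card ≤ a := by
      have : s ⊆ Finset.range a := fun x hx => Finset.mem_range.2 (hmax x hx)
      simpa using Finset.card_le_card this
    have := hf this
    linarith

lemma comb_bound {N : ℕ} (NB : ℕ) (Δ : ℕ → ℝ)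
    (hpos : ∀ n, n < NB → 0 < Δ n)
    (hdesc : ∀ m n : ℕ, m ≤ n → n < NB → Δ n ≤ Δ m)
    (k : ℕ) (hk : 1 ≤ k) (M : ℕ) (c : Fin N → Fin M)
    (hc : ∀ m, (Finset.univ.filter (fun i => c i = m)).card ≤ k) :
    ∑ m, (∑ i ∈ Finset.univ.filter (fun i : Fin N => i.val < NB ∧ c i = m), Δ i.val) ^ 2 ≤
    (∑ l ∈ Finset.range (NB / k), (∑ j ∈ Finset.range k, Δ (k * l + j)) ^ 2)
    + (∑ j ∈ Finset.range (NB % k), Δ (k * (NB / k) + j)) ^ 2 := by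
  set D : ℕ → ℝ := fun n => if n < NB then Δ n else 0 with hD
  have hD0 : ∀ n, 0 ≤ D n := by
    intro n; simp only [hD]; split_ifs with h
    · exact (hpos n h).le
    · exact le_rfl
  have hDa : Antitone D := by
    intro m n hmn
    by_cases h : n < NB
    · have : m < NB := by omega
      simp only [hD, h, this, if_true]; exact hdesc m n hmn h
    · have := hD0 m
      simp only [hD, h, if_false] at this ⊢; exact this
  set v : ℕ → ℝ := fun l => ∑ j ∈ Finset.range k, D (k * l + j) with hv
  have hvsum : ∀ t, ∑ l ∈ Finset.range t, v l = ∑ n ∈ Finset.range (k * t), D n := by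
    intro t
    induction t with
    | zero => simp
    | succ t ih => rw [Finset.sum_range_succ, ih, Nat.mul_succ, Finset.sum_range_add]
  have hw : ∀ m, (∑ i ∈ Finset.univ.filter (fun i : Fin N => i.val < NB ∧ c i = m), Δ i.val)
      = ∑ i ∈ Finset.univ.filter (fun i => c i = m), D i.val := by
    intro m
    rw [Finset.sum_filter, Finset.sum_filter]
    refine Finset.sum_congr rfl fun i _ => ?_
    by_cases h1 : i.val < NB <;> by_cases h2 : c i = m <;> simp [hD, h1, h2]
  simp_rw [hw]
  have key := sumsq_le_aux (fun m => ∑ i ∈ Finset.univ.filter (fun i => c i = m), D i.val) v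
    Finset.univ (fun T _ => by
      rw [hvsum]
      rw [← Finset.sum_biUnion (by
        intro a _ b _ hab
        refine Finset.disjoint_left.2 fun i h1 h2 => hab ?_
        simp at h1 h2; rw [← h1, ← h2])]
      set A := T.biUnion fun m => Finset.univ.filter (fun i => c i = m) with hA
      have hcard : A.card ≤ k * T.card := by
        rw [mul_comm]; exact Finset.card_biUnion_le_card_mul _ _ _ (fun m _ => hc m)
      calc ∑ i ∈ A, D i.val = ∑ n ∈ A.map Fin.valEmbedding, D n := by simp
        _ ≤ ∑ n ∈ Finset.range (A.map Fin.valEmbedding).card, D n := sum_le_range D hDa _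
        _ ≤ _ := by
          rw [Finset.card_map]
          exact Finset.sum_le_sum_of_subset_of_nonneg (Finset.range_subset_range.2 hcard) (fun n _ _ => hD0 n)) 0
    (fun m _ => Finset.sum_nonneg fun i _ => hD0 _)
  have key2 : ∑ m, (∑ i ∈ Finset.univ.filter (fun i => c i = m), D i.val) ^ 2 ≤
    ∑ l ∈ Finset.range M, v l ^ 2 := by simpa using key
  refine key2.trans ?_
  have hdm := Nat.div_add_mod NB k
  have hlt := Nat.mod_lt NB (show k > 0 by omega)
  have hvz : ∀ l, NB / k + 1 ≤ l → v l = 0 := by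
    intro l hl
    refine Finset.sum_eq_zero fun j _ => ?_
    have : k * (NB / k + 1) ≤ k * l := Nat.mul_le_mul_left k hl
    rw [Nat.mul_succ] at this
    have : ¬ (k * l + j < NB) := by omega
    simp [hD, this]
  have h1 : ∑ l ∈ Finset.range M, v l ^ 2 ≤ ∑ l ∈ Finset.range (NB / k + 1), v l ^ 2 := by
    have : ∑ l ∈ Finset.range M, v l ^ 2 ≤ ∑ l ∈ Finset.range (max M (NB / k + 1)), v l ^ 2 :=
      Finset.sum_le_sum_of_subset_of_nonneg (Finset.range_subset_range.2 (le_max_left _ _)) (fun n _ _ => sq_nonneg _)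
    refine this.trans_eq (Finset.sum_subset (Finset.range_subset_range.2 (le_max_right _ _)) ?_).symm
    intro l _ hl
    rw [hvz l (by simpa using hl)]; simp
  refine h1.trans_eq ?_
  rw [Finset.sum_range_succ]
  congr 1
  · refine Finset.sum_congr rfl fun l hl => ?_
    congr 1
    refine Finset.sum_congr rfl fun j hj => ?_
    simp only [Finset.mem_range] at hl hj
    have : k * (l + 1) ≤ k * (NB / k) := Nat.mul_le_mul_left k hl
    rw [Nat.mul_succ] at this
    have : k * l + j < NB := by omega
    simp [hD, this]
  · congr 1
    symm
    have : ∑ j ∈ Finset.range (NB % k), Δ (k * (NB / k) + j) = ∑ j ∈ Finset.range (NB % k), D (k * (NB / k) + j) := by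
      refine Finset.sum_congr rfl fun j hj => ?_
      simp only [Finset.mem_range] at hj
      have : k * (NB / k) + j < NB := by omega
      simp [hD, this]
    rw [this]
    refine Finset.sum_subset (Finset.range_subset_range.2 hlt.le) ?_
    intro j _ hj
    simp only [Finset.mem_range] at hj
    have : ¬ k * (NB / k) + j < NB := by omega
    simp [hD, this]

noncomputable def nsq {ι : Type*} [Fintype ι] (v : ι → ℂ) : ℝ := ∑ x, ‖v x‖ ^ 2

lemma nsq_eq {ι : Type*} [Fintype ι] (v : ι → ℂ) : ((nsq v : ℝ) : ℂ) = star v ⬝ᵥ v := by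
  simp only [nsq, dotProduct, Pi.star_apply, Complex.ofReal_sum]
  refine Finset.sum_congr rfl fun x _ => ?_
  rw [Complex.star_def, Complex.conj_mul']; push_cast; rfl

lemma nsq_norm {ι : Type*} [Fintype ι] (v : ι → ℂ) : nsq v = ‖WithLp.toLp 2 v‖ ^ 2 := by
  rw [EuclideanSpace.norm_sq_eq]; rfl

lemma inner_dot {ι : Type*} [Fintype ι] (v w : ι → ℂ) :
    inner ℂ (WithLp.toLp 2 v) (WithLp.toLp 2 w) = star v ⬝ᵥ w := by
  rw [EuclideanSpace.inner_eq_star_dotProduct, dotProduct_comm]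

lemma cs_dot {ι : Type*} [Fintype ι] (v w : ι → ℂ) :
    ‖star v ⬝ᵥ w‖ ^ 2 ≤ nsq v * nsq w := by
  rw [← inner_dot, nsq_norm, nsq_norm, ← mul_pow]
  exact pow_le_pow_left₀ (norm_nonneg _) (norm_inner_le_norm _ _) 2

lemma conv_diag {ι : Type*} [Fintype ι] [DecidableEq ι] (p : ι → ℝ) (hp : ∀ x, 0 ≤ p x)
    (O : Matrix ι ι ℂ) (hO : O.IsHermitian) {K : ℕ} (q : Fin K → ℝ) (hq : ∀ ν, 0 ≤ q ν)
    (Φ : Fin K → ι → ℂ) (hu : ∀ ν, nsq (Φ ν) = 1)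
    (hρ : ∀ l l', ∑ ν, (q ν : ℂ) * (Φ ν l * star (Φ ν l')) = if l = l' then (p l : ℂ) else 0) :
    (2 * ∑ l, ∑ l', if 0 < p l + p l' then
    (p l - p l') ^ 2 / (p l + p l') * Complex.normSq (O l l')
      else 0) ≤ ∑ ν, q ν * (4 * (nsq (O *ᵥ Φ ν) - ‖star (Φ ν) ⬝ᵥ (O *ᵥ Φ ν)‖ ^ 2)) := by
  have key : ∀ A : Matrix ι ι ℂ, ∑ ν, q ν * nsq (A *ᵥ Φ ν) = ∑ l, ∑ l', ‖A l l'‖ ^ 2 * p l' := by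
    intro A
    apply Complex.ofReal_injective
    push_cast
    simp_rw [nsq_eq]
    simp only [dotProduct, mulVec, Pi.star_apply, star_sum, star_mul', Finset.mul_sum, Finset.sum_mul]
    rw [Finset.sum_comm]
    refine Finset.sum_congr rfl fun l _ => ?_
    rw [Finset.sum_comm]
    refine Finset.sum_congr rfl fun a _ => ?_
    rw [Finset.sum_comm]
    have : ∀ b, ∑ ν, (q ν : ℂ) * (star (A l b) * star (Φ ν b) * (A l a * Φ ν a)) =
      star (A l b) * A l a * (if a = b then (p a : ℂ) else 0) := by
      intro b
      rw [← hρ, Finset.mul_sum]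
      refine Finset.sum_congr rfl fun ν _ => ?_
      ring
    simp_rw [this]
    simp [Complex.conj_mul']
  set W : Matrix ι ι ℂ := fun l l' => if 0 < p l + p l' then (((2 * p l / (p l + p l') : ℝ)) : ℂ) * O l l' else O l l' with hW
  have hWO : W + Wᴴ = (2 : ℂ) • O := by
    ext l l'
    have hh : star (O l' l) = O l l' := by
      have := congrFun (congrFun hO l) l'; simpa [conjTranspose_apply] using this
    rw [Matrix.add_apply, conjTranspose_apply, Matrix.smul_apply]
    simp only [hW, smul_eq_mul, add_comm (p l') (p l)]
    split_ifs with h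
    · rw [star_mul', hh, Complex.star_def, Complex.conj_ofReal, ← add_mul, ← Complex.ofReal_add]
      congr 1
      rw [← add_div, ← mul_add, mul_div_assoc, div_self h.ne']; simp
    · rw [hh]; ring
  have hb : ∀ ν, ‖star (Φ ν) ⬝ᵥ (O *ᵥ Φ ν)‖ ^ 2 ≤ nsq (W *ᵥ Φ ν) := by
    intro ν
    have h1 : (2 : ℂ) * (star (Φ ν) ⬝ᵥ (O *ᵥ Φ ν)) =
      star (Φ ν) ⬝ᵥ (W *ᵥ Φ ν) + star (star (Φ ν) ⬝ᵥ (W *ᵥ Φ ν)) := by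
      rw [← smul_eq_mul, ← dotProduct_smul, ← smul_mulVec, ← hWO, add_mulVec, dotProduct_add]
      congr 1
      rw [star_dotProduct]
      congr 1
      rw [star_mulVec, conjTranspose_conjTranspose, ← dotProduct_mulVec]
    have h2 : ‖star (Φ ν) ⬝ᵥ (O *ᵥ Φ ν)‖ ≤ ‖star (Φ ν) ⬝ᵥ (W *ᵥ Φ ν)‖ := by
      have := norm_add_le (star (Φ ν) ⬝ᵥ (W *ᵥ Φ ν)) (star (star (Φ ν) ⬝ᵥ (W *ᵥ Φ ν)))
      rw [← h1, norm_star, norm_mul] at this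
      norm_num at this; linarith
    calc _ ≤ ‖star (Φ ν) ⬝ᵥ (W *ᵥ Φ ν)‖ ^ 2 := pow_le_pow_left₀ (norm_nonneg _) h2 2
      _ ≤ nsq (Φ ν) * nsq (W *ᵥ Φ ν) := cs_dot _ _
      _ = _ := by rw [hu, one_mul]
  have h3 : 4 * (∑ l, ∑ l', ‖O l l'‖ ^ 2 * p l') - 4 * (∑ l, ∑ l', ‖W l l'‖ ^ 2 * p l') ≤ 
     ∑ ν, q ν * (4 * (nsq (O *ᵥ Φ ν) - ‖star (Φ ν) ⬝ᵥ (O *ᵥ Φ ν)‖ ^ 2)) := by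
    rw [← key, ← key, Finset.mul_sum, Finset.mul_sum, ← Finset.sum_sub_distrib]
    refine Finset.sum_le_sum fun ν _ => ?_
    have := mul_le_mul_of_nonneg_left (hb ν) (hq ν)
    linarith
  refine le_trans (le_of_eq ?_) h3
  set G : ι → ι → ℝ := fun l l' => 4 * (‖O l l'‖ ^ 2 * p l') - 4 * (‖W l l'‖ ^ 2 * p l') with hG
  have h4 : 4 * (∑ l, ∑ l', ‖O l l'‖ ^ 2 * p l') - 4 * (∑ l, ∑ l', ‖W l l'‖ ^ 2 * p l') = 
    ∑ l, ∑ l', G l l' := by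
    simp only [hG, Finset.sum_sub_distrib, Finset.mul_sum]
  have h5 : ∑ l, ∑ l', G l l' = ∑ l, ∑ l', (G l l' + G l' l) / 2 := by
    simp only [add_div, Finset.sum_add_distrib, ← Finset.sum_div]
    rw [Finset.sum_comm (f := fun l l' => G l' l)]; ring
  rw [h4, h5, Finset.mul_sum]
  refine Finset.sum_congr rfl fun l _ => ?_
  rw [Finset.mul_sum]
  refine Finset.sum_congr rfl fun l' _ => ?_
  have hh : ‖O l' l‖ = ‖O l l'‖ := by
    have := congrFun (congrFun hO l) l'
    rw [conjTranspose_apply] at this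
    rw [← this, norm_star]
  simp only [hG, hW, add_comm (p l') (p l), Complex.normSq_eq_norm_sq]
  split_ifs with h
  · rw [norm_mul, norm_mul, hh, Complex.norm_real, Complex.norm_real, mul_pow, mul_pow, Real.norm_eq_abs,
      Real.norm_eq_abs, sq_abs, sq_abs]
    field_simp
    ring
  · ring

lemma conv_gen {ι : Type*} [Fintype ι] [DecidableEq ι] (p : ι → ℝ) (hp : ∀ x, 0 ≤ p x)
    (e : ι → ι → ℂ) (horth : ∀ x y, star (e x) ⬝ᵥ e y = if x = y then 1 else 0)
    (O : Matrix ι ι ℂ) (hO : O.IsHermitian) {K : ℕ} (q : Fin K → ℝ) (hq : ∀ ν, 0 ≤ q ν)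
    (Ψ : Fin K → ι → ℂ) (hu : ∀ ν, nsq (Ψ ν) = 1)
    (hρ : ∑ x, (p x : ℂ) • Matrix.vecMulVec (e x) (star (e x))
        = ∑ ν, (q ν : ℂ) • Matrix.vecMulVec (Ψ ν) (star (Ψ ν))) :
    (2 * ∑ l, ∑ l', if 0 < p l + p l' then
    (p l - p l') ^ 2 / (p l + p l') * Complex.normSq (star (e l) ⬝ᵥ O.mulVec (e l'))
      else 0) ≤ ∑ ν, q ν * (4 * (nsq (O *ᵥ Ψ ν) - ‖star (Ψ ν) ⬝ᵥ (O *ᵥ Ψ ν)‖ ^ 2)) := by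
  set U : Matrix ι ι ℂ := fun x l => e l x with hU
  have hUU : Uᴴ * U = 1 := by
    ext x y
    rw [Matrix.one_apply, ← horth]; rfl
  have hUU' : U * Uᴴ = 1 := mul_eq_one_comm.1 hUU
  have hrow : ∀ l (w : ι → ℂ), (Uᴴ *ᵥ w) l = star (e l) ⬝ᵥ w := fun l w => rfl
  have hdot : ∀ v w : ι → ℂ, star (Uᴴ *ᵥ v) ⬝ᵥ (Uᴴ *ᵥ w) = star v ⬝ᵥ w := by
    intro v w
    rw [star_mulVec, conjTranspose_conjTranspose, ← dotProduct_mulVec, mulVec_mulVec, hUU', one_mulVec]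
  have hnsq : ∀ v : ι → ℂ, nsq (Uᴴ *ᵥ v) = nsq v := by
    intro v
    apply Complex.ofReal_injective
    rw [nsq_eq, nsq_eq, hdot]
  have hOU : ∀ v, (Uᴴ * O * U) *ᵥ (Uᴴ *ᵥ v) = Uᴴ *ᵥ (O *ᵥ v) := by
    intro v
    rw [mulVec_mulVec, mul_assoc, hUU', mul_one, mulVec_mulVec]
  have := conv_diag p hp (Uᴴ * O * U) (isHermitian_conjTranspose_mul_mul U hO) q hq (fun ν => Uᴴ *ᵥ Ψ ν)
    (fun ν => by rw [hnsq, hu]) (by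
      intro l l'
      have h1 := congrArg (fun R : Matrix ι ι ℂ => star (e l) ⬝ᵥ (R *ᵥ (e l'))) hρ
      simp only [sum_mulVec, dotProduct_sum, smul_mulVec, dotProduct_smul, vecMulVec_mulVec, 
        horth, op_smul_eq_smul, smul_eq_mul] at h1
      simp only [hrow]
      have h2 : ∀ ν, star (star (e l') ⬝ᵥ Ψ ν) = star (Ψ ν) ⬝ᵥ e l' := by
        intro ν; rw [star_dotProduct, star_star, dotProduct_comm]
      simp_rw [h2]
      rw [Finset.sum_congr rfl (g := fun ν => (q ν : ℂ) * ((star (Ψ ν) ⬝ᵥ e l') * (star (e l) ⬝ᵥ Ψ ν))) (fun ν _ => by ring), ← h1]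
      simp [eq_comm])
  simp only [hOU, hnsq, hdot] at this
  have hent : ∀ l l', (Uᴴ * O * U) l l' = star (e l) ⬝ᵥ O.mulVec (e l') := by
    intro l l'
    rw [mul_assoc]; rfl
  simp only [hent] at this
  exact this

lemma var_abs1 {E : Type*} [NormedAddCommGroup E] [InnerProductSpace ℂ E] (ψ v : E) (hψ : ‖ψ‖ = 1) :
    ‖v - (inner ℂ ψ v) • ψ‖ ^ 2 = ‖v‖ ^ 2 - ‖(inner ℂ ψ v : ℂ)‖ ^ 2 := by
  have hψ' : inner ℂ ψ ψ = (1 : ℂ) := by rw [inner_self_eq_norm_sq_to_K, hψ]; simp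
  have hv : inner ℂ v v = ((‖v‖ ^ 2 : ℝ) : ℂ) := by rw [inner_self_eq_norm_sq_to_K]; simp
  apply Complex.ofReal_injective
  have : inner ℂ (v - (inner ℂ ψ v : ℂ) • ψ) (v - (inner ℂ ψ v : ℂ) • ψ) =
      ((‖v - (inner ℂ ψ v : ℂ) • ψ‖ ^ 2 : ℝ) : ℂ) := by rw [inner_self_eq_norm_sq_to_K]; simp
  rw [← this]
  simp only [inner_sub_left, inner_sub_right, inner_smul_left, inner_smul_right, hψ', hv]
  push_cast
  rw [← Complex.conj_mul', inner_conj_symm]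
  ring

lemma var_abs {E : Type*} [NormedAddCommGroup E] [InnerProductSpace ℂ E] (ψ : E) (hψ : ‖ψ‖ = 1)
    {M : ℕ} (a : Fin M → E)
    (h : ∀ m m', m ≠ m' → inner ℂ (a m) (a m') = (inner ℂ (a m) ψ : ℂ) * inner ℂ ψ (a m'))
    (c : Fin M → ℂ) (r : Fin M → ℝ) (hr : ∀ m, ‖a m - c m • ψ‖ ≤ r m) :
    ‖∑ m, a m‖ ^ 2 - ‖(inner ℂ ψ (∑ m, a m) : ℂ)‖ ^ 2 ≤ ∑ m, r m ^ 2 := by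
  have hψ' : inner ℂ ψ ψ = (1 : ℂ) := by rw [inner_self_eq_norm_sq_to_K, hψ]; simp
  rw [← var_abs1 ψ _ hψ]
  set u : Fin M → E := fun m => a m - (inner ℂ ψ (a m) : ℂ) • ψ with hu
  have h1 : ∑ m, a m - (inner ℂ ψ (∑ m, a m) : ℂ) • ψ = ∑ m, u m := by
    rw [inner_sum, Finset.sum_smul, ← Finset.sum_sub_distrib]
  have h2 : ∀ m m', m ≠ m' → inner ℂ (u m) (u m') = (0 : ℂ) := by
    intro m m' hm
    simp only [hu, inner_sub_left, inner_sub_right, inner_smul_left, inner_smul_right, hψ', h m m' hm,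
      inner_conj_symm]
    ring
  have h3 : ‖∑ m, u m‖ ^ 2 = ∑ m, ‖u m‖ ^ 2 := by
    apply Complex.ofReal_injective
    have hv : ∀ v : E, ((‖v‖ ^ 2 : ℝ) : ℂ) = inner ℂ v v := by
      intro v; rw [inner_self_eq_norm_sq_to_K]; simp
    rw [Complex.ofReal_sum]
    simp_rw [hv]
    rw [sum_inner]
    refine Finset.sum_congr rfl fun m _ => ?_
    rw [inner_sum]
    exact Finset.sum_eq_single m (fun m' _ hm => h2 m m' hm.symm) (by simp)
  rw [h1, h3]
  refine Finset.sum_le_sum fun m _ => ?_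
  have h4 := var_abs1 ψ (a m - c m • ψ) hψ
  have h5 : (a m - c m • ψ) - (inner ℂ ψ (a m - c m • ψ) : ℂ) • ψ = u m := by
    simp only [hu, inner_sub_right, inner_smul_right, hψ', mul_one, sub_smul]
    abel
  rw [h5] at h4
  rw [h4]
  have := pow_le_pow_left₀ (norm_nonneg _) (hr m) 2
  nlinarith [sq_nonneg ‖(inner ℂ ψ (a m - c m • ψ) : ℂ)‖]

lemma spec_bound {n : ℕ} (A : Matrix (Fin n) (Fin n) ℂ) (hA : A.IsHermitian) (lo hi : ℝ)
    (hhi : IsGreatest {μ : ℝ | ∃ v : Fin n → ℂ, v ≠ 0 ∧ A.mulVec v = (μ : ℂ) • v} hi)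
    (hlo : IsLeast {μ : ℝ | ∃ v : Fin n → ℂ, v ≠ 0 ∧ A.mulVec v = (μ : ℂ) • v} lo)
    (v : Fin n → ℂ) :
    nsq ((A - (((hi + lo) / 2 : ℝ) : ℂ) • (1 : Matrix (Fin n) (Fin n) ℂ)) *ᵥ v) ≤ ((hi - lo) / 2) ^ 2 * nsq v := by
  set b := hA.eigenvectorBasis with hb
  have hev : ∀ j, A *ᵥ (b j).ofLp = ((hA.eigenvalues j : ℝ) : ℂ) • (b j).ofLp := by
    intro j
    rw [hb, hA.mulVec_eigenvectorBasis j]; ext; simp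
  have hmem : ∀ j, hA.eigenvalues j ∈ {μ : ℝ | ∃ v : Fin n → ℂ, v ≠ 0 ∧ A.mulVec v = (μ : ℂ) • v} := by
    intro j
    refine ⟨(b j).ofLp, ?_, hev j⟩
    intro h0
    have := b.orthonormal.ne_zero j
    apply this
    ext x; exact congrFun h0 x
  set B := A - (((hi + lo) / 2 : ℝ) : ℂ) • (1 : Matrix (Fin n) (Fin n) ℂ) with hB
  have hn : ∀ w : Fin n → ℂ, nsq w = ∑ j, ‖star (b j).ofLp ⬝ᵥ w‖ ^ 2 := by
    intro w
    rw [nsq_norm, ← b.sum_sq_norm_inner_right]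
    simp_rw [← inner_dot]
  have hin : ∀ j, star (b j).ofLp ⬝ᵥ (B *ᵥ v) =
      ((hA.eigenvalues j - (hi + lo) / 2 : ℝ) : ℂ) * (star (b j).ofLp ⬝ᵥ v) := by
    intro j
    have h1 : star (b j).ofLp ⬝ᵥ (A *ᵥ v) = (hA.eigenvalues j : ℂ) * (star (b j).ofLp ⬝ᵥ v) := by
      rw [dotProduct_mulVec]
      nth_rewrite 1 [← hA.eq]
      rw [← star_mulVec, hev j, star_smul, smul_dotProduct]
      simp
    rw [hB, sub_mulVec, smul_mulVec, one_mulVec, dotProduct_sub, dotProduct_smul, h1, smul_eq_mul]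
    push_cast; ring
  rw [hn, hn, Finset.mul_sum]
  refine Finset.sum_le_sum fun j _ => ?_
  rw [hin, norm_mul, mul_pow]
  refine mul_le_mul_of_nonneg_right ?_ (sq_nonneg _)
  rw [Complex.norm_real, Real.norm_eq_abs, sq_abs]
  have h1 := hhi.2 (hmem j)
  have h2 := hlo.2 (hmem j)
  nlinarith

lemma localOp_mulVec {N : ℕ} {d : Fin N → ℕ} (i : Fin N)
    (A : Matrix (Fin (d i)) (Fin (d i)) ℂ) (Ψ : (∀ i, Fin (d i)) → ℂ) (x : ∀ i, Fin (d i)) :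
    (localOp i A *ᵥ Ψ) x = ∑ a, A (x i) a * Ψ (Function.update x i a) := by
  have h0 : (localOp i A *ᵥ Ψ) x =
      ∑ y, A (x i) (y i) * (if ∀ j, j ≠ i → x j = y j then 1 else 0) * Ψ y := rfl
  rw [h0]
  symm
  refine Finset.sum_of_injOn (fun a => Function.update x i a) ?_ ?_ ?_ ?_
  · intro a _ b _ h
    exact Function.update_injective x i h
  · intro a _; simp
  · intro y _ hy
    rw [if_neg]
    · simp
    · intro h
      apply hy
      refine ⟨y i, by simp, ?_⟩
      ext1 j
      by_cases hj : j = i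
      · subst hj; simp
      · simp [Function.update_of_ne hj, h j hj]
  · intro a _
    rw [if_pos]
    · simp
    · intro j hj; simp [Function.update_of_ne hj]

lemma localOp_herm {N : ℕ} {d : Fin N → ℕ} (i : Fin N)
    (A : Matrix (Fin (d i)) (Fin (d i)) ℂ) (hA : A.IsHermitian) : (localOp i A).IsHermitian := by
  ext x y
  have h := congrFun (congrFun hA (x i)) (y i)
  rw [conjTranspose_apply] at h ⊢
  unfold localOp
  rw [star_mul', h]
  congr 1
  simp only [eq_comm]
  split_ifs <;> simp

lemma localOp_bound {N : ℕ} {d : Fin N → ℕ} (i : Fin N)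
    (A : Matrix (Fin (d i)) (Fin (d i)) ℂ) (C : ℝ) (hA : ∀ v, nsq (A *ᵥ v) ≤ C * nsq v)
    (Ψ : (∀ i, Fin (d i)) → ℂ) : nsq (localOp i A *ᵥ Ψ) ≤ C * nsq Ψ := by
  set E := Equiv.piSplitAt i (fun j => Fin (d j)) with hE
  have h0 : ∀ F : (∀ i, Fin (d i)) → ℂ, nsq F = ∑ z, nsq (fun b => F (E.symm (b, z))) := by
    intro F
    unfold nsq
    rw [← E.symm.sum_comp, Fintype.sum_prod_type_right]
  rw [h0, h0 Ψ, Finset.mul_sum]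
  refine Finset.sum_le_sum fun z _ => ?_
  refine le_trans (le_of_eq ?_) (hA _)
  congr 1
  ext b
  rw [localOp_mulVec]
  have h1 : E.symm (b, z) i = b := by simp [hE, Equiv.piSplitAt]
  have h2 : ∀ a, Function.update (E.symm (b, z)) i a = E.symm (a, z) := by
    intro a
    ext1 j
    by_cases hj : j = i
    · subst hj; simp [hE, Equiv.piSplitAt]
    · simp [hE, Equiv.piSplitAt, hj]
  simp_rw [h1, h2]
  rfl

def mixF {N M : ℕ} {d : Fin N → ℕ} (c : Fin N → Fin M) (m : Fin M) (x y : ∀ i, Fin (d i)) :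
    ∀ i, Fin (d i) := fun t => if c t = m then x t else y t

lemma cov_zero {N M : ℕ} {d : Fin N → ℕ} (c : Fin N → Fin M) (Ψ : (∀ i, Fin (d i)) → ℂ)
    (φ : ∀ m : Fin M, ((∀ i : {i : Fin N // c i = m}, Fin (d i.val)) → ℂ))
    (hΨ : ∀ x, Ψ x = ∏ m, φ m (fun i => x i.val)) (hu : star Ψ ⬝ᵥ Ψ = 1) (i j : Fin N)
    (hij : c i ≠ c j) (A : Matrix (Fin (d i)) (Fin (d i)) ℂ) (B : Matrix (Fin (d j)) (Fin (d j)) ℂ) :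
    star (localOp i A *ᵥ Ψ) ⬝ᵥ (localOp j B *ᵥ Ψ) =
      (star (localOp i A *ᵥ Ψ) ⬝ᵥ Ψ) * (star Ψ ⬝ᵥ (localOp j B *ᵥ Ψ)) := by
  set m := c i with hm
  have hmix : ∀ x y, Ψ (mixF c m x y) * Ψ (mixF c m y x) = Ψ x * Ψ y := by
    intro x y
    simp only [hΨ, ← Finset.prod_mul_distrib]
    refine Finset.prod_congr rfl fun m' _ => ?_
    by_cases h : m' = m
    · have h1 : ∀ x y : ∀ i, Fin (d i), (fun i : {i : Fin N // c i = m'} => mixF c m x y i.val) = fun i : {i : Fin N // c i = m'} => x i.val := by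
        intro x y; ext1 i; simp [mixF, i.2, h]
      rw [h1, h1]
    · have h1 : ∀ x y : ∀ i, Fin (d i), (fun i : {i : Fin N // c i = m'} => mixF c m x y i.val) = fun i : {i : Fin N // c i = m'} => y i.val := by
        intro x y; ext1 i; simp [mixF, i.2, h]
      rw [h1, h1, mul_comm]
  have hA : ∀ x y, (localOp i A *ᵥ Ψ) (mixF c m x y) * Ψ (mixF c m y x) = (localOp i A *ᵥ Ψ) x * Ψ y := by
    intro x y
    rw [localOp_mulVec, localOp_mulVec, Finset.sum_mul, Finset.sum_mul]
    refine Finset.sum_congr rfl fun a _ => ?_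
    have h1 : mixF c m x y i = x i := by simp [mixF, hm]
    have h2 : Function.update (mixF c m x y) i a = mixF c m (Function.update x i a) y := by
      ext1 t
      by_cases ht : t = i
      · subst ht; simp [mixF, hm]
      · simp [mixF, ht]
    have h3 : mixF c m y x = mixF c m y (Function.update x i a) := by
      ext1 t
      by_cases ht : t = i
      · subst ht; simp [mixF, hm]
      · simp [mixF, ht]
    rw [h1, h2, h3, mul_assoc, hmix, mul_assoc]
  have hB : ∀ x y, Ψ (mixF c m x y) * (localOp j B *ᵥ Ψ) (mixF c m y x) = (localOp j B *ᵥ Ψ) x * Ψ y := by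
    intro x y
    rw [localOp_mulVec, localOp_mulVec, Finset.mul_sum, Finset.sum_mul]
    refine Finset.sum_congr rfl fun a _ => ?_
    have h1 : mixF c m y x j = x j := by simp [mixF, hij.symm]
    have h2 : Function.update (mixF c m y x) j a = mixF c m y (Function.update x j a) := by
      ext1 t
      by_cases ht : t = j
      · subst ht; simp [mixF, hij.symm]
      · simp [mixF, ht]
    have h3 : mixF c m x y = mixF c m (Function.update x j a) y := by
      ext1 t
      by_cases ht : t = j
      · subst ht; simp [mixF, hij.symm]
      · simp [mixF, ht]
    rw [h1, h2, h3, mul_left_comm, hmix, mul_assoc]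
  have hinv : Function.Involutive (fun P : (∀ i, Fin (d i)) × (∀ i, Fin (d i)) =>
      (mixF c m P.1 P.2, mixF c m P.2 P.1)) := by
    rintro ⟨x, y⟩
    ext1 <;> ext1 t <;> by_cases ht : c t = m <;> simp [mixF, ht]
  have h1 : star (localOp i A *ᵥ Ψ) ⬝ᵥ (localOp j B *ᵥ Ψ) =
    (star (localOp i A *ᵥ Ψ) ⬝ᵥ (localOp j B *ᵥ Ψ)) * (star Ψ ⬝ᵥ Ψ) := by rw [hu, mul_one]
  rw [h1]
  unfold dotProduct
  rw [Finset.sum_mul_sum, Finset.sum_mul_sum, ← Fintype.sum_prod_type', ← Fintype.sum_prod_type']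
  refine Eq.trans ?_ (Equiv.sum_comp (hinv.toPerm _)
    (fun P => star (localOp i A *ᵥ Ψ) P.1 * Ψ P.1 * (star Ψ P.2 * (localOp j B *ᵥ Ψ) P.2)))
  refine Finset.sum_congr rfl fun P _ => ?_
  obtain ⟨x, y⟩ := P
  simp only [Function.Involutive.coe_toPerm, Pi.star_apply]
  have e1 := congrArg star (hA x y)
  have e2 := hB x y
  rw [star_mul', star_mul'] at e1
  calc _ = (star ((localOp i A *ᵥ Ψ) x) * star (Ψ y)) * ((localOp j B *ᵥ Ψ) x * Ψ y) := by ring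
    _ = _ := by rw [← e1, ← e2]; ring

lemma local_norm {N : ℕ} {d : Fin N → ℕ} (i : Fin N) (A : Matrix (Fin (d i)) (Fin (d i)) ℂ)
    (C : ℂ) (r : ℝ) (hr : 0 ≤ r) (hC : ∀ v, nsq ((A - C • 1) *ᵥ v) ≤ r ^ 2 * nsq v)
    (Ψ : (∀ i, Fin (d i)) → ℂ) (hn1 : nsq Ψ = 1) :
    ‖WithLp.toLp 2 (localOp i A *ᵥ Ψ) - C • WithLp.toLp 2 Ψ‖ ≤ r := by
  have h1 := localOp_bound i _ _ hC Ψ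
  have h2 : localOp i (A - C • 1) *ᵥ Ψ = localOp i A *ᵥ Ψ - C • Ψ := by
    ext x
    rw [localOp_mulVec, Pi.sub_apply, Pi.smul_apply, localOp_mulVec]
    simp only [Matrix.sub_apply, Matrix.smul_apply, sub_mul,
      Finset.sum_sub_distrib, Matrix.one_apply]
    simp
  rw [hn1, mul_one, h2, nsq_norm, WithLp.toLp_sub, WithLp.toLp_smul] at h1
  exact abs_le_of_sq_le_sq' h1 hr |>.2

lemma var_bound {N : ℕ} (NB : ℕ) {d : Fin N → ℕ}
    (O : ∀ i, Matrix (Fin (d i)) (Fin (d i)) ℂ)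
    (C : Fin N → ℝ) (Δ : ℕ → ℝ) (hpos : ∀ n, n < NB → 0 < Δ n)
    (hC : ∀ i : Fin N, i.val < NB → ∀ v, nsq ((O i - (C i : ℂ) • 1) *ᵥ v) ≤ (Δ i.val / 2) ^ 2 * nsq v)
    {M : ℕ} (c : Fin N → Fin M) (Ψ : (∀ i, Fin (d i)) → ℂ)
    (φ : ∀ m : Fin M, ((∀ i : {i : Fin N // c i = m}, Fin (d i.val)) → ℂ))
    (hΨ : ∀ x, Ψ x = ∏ m, φ m (fun i => x i.val)) (hu : star Ψ ⬝ᵥ Ψ = 1) :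
    4 * (nsq ((∑ i ∈ Finset.univ.filter (fun i : Fin N => i.val < NB), localOp i (O i)) *ᵥ Ψ) -
      ‖star Ψ ⬝ᵥ ((∑ i ∈ Finset.univ.filter (fun i : Fin N => i.val < NB), localOp i (O i)) *ᵥ Ψ)‖ ^ 2) ≤
     ∑ m, (∑ i ∈ Finset.univ.filter (fun i : Fin N => i.val < NB ∧ c i = m), Δ i.val) ^ 2 := by
  have hn1 : nsq Ψ = 1 := by
    apply Complex.ofReal_injective; rw [nsq_eq, hu]; simp
  have hψ : ‖WithLp.toLp 2 Ψ‖ = 1 := by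
    rw [nsq_norm] at hn1
    exact (pow_eq_one_iff_of_nonneg (norm_nonneg _) two_ne_zero).1 hn1
  set S : Fin M → Finset (Fin N) := fun m => Finset.univ.filter (fun i : Fin N => i.val < NB ∧ c i = m) with hS
  set a : Fin M → EuclideanSpace ℂ (∀ i, Fin (d i)) := fun m => ∑ i ∈ S m, WithLp.toLp 2 (localOp i (O i) *ᵥ Ψ) with ha
  have hsum : WithLp.toLp 2 ((∑ i ∈ Finset.univ.filter (fun i : Fin N => i.val < NB), localOp i (O i)) *ᵥ Ψ) = ∑ m, a m := by
    rw [sum_mulVec, WithLp.toLp_sum, ← Finset.sum_fiberwise _ c]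
    refine Finset.sum_congr rfl fun m _ => ?_
    rw [Finset.filter_filter]
  have hcov : ∀ m m', m ≠ m' → inner ℂ (a m) (a m') =
      (inner ℂ (a m) (WithLp.toLp 2 Ψ) : ℂ) * inner ℂ (WithLp.toLp 2 Ψ) (a m') := by
    intro m m' hm
    simp only [ha]
    rw [sum_inner, sum_inner, inner_sum, Finset.sum_mul_sum]
    simp only [inner_sum, inner_dot]
    refine Finset.sum_congr rfl fun i hi => Finset.sum_congr rfl fun j hj => ?_
    simp only [hS, Finset.mem_filter] at hi hj
    exact cov_zero c Ψ φ hΨ hu i j (by rw [hi.2.2, hj.2.2]; exact hm) _ _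
  have hr : ∀ m, ‖a m - (∑ i ∈ S m, (C i : ℂ)) • WithLp.toLp 2 Ψ‖ ≤ ∑ i ∈ S m, Δ i.val / 2 := by
    intro m
    rw [Finset.sum_smul]
    simp only [ha]
    rw [← Finset.sum_sub_distrib]
    refine (norm_sum_le _ _).trans (Finset.sum_le_sum fun i hi => ?_)
    simp only [hS, Finset.mem_filter] at hi
    exact local_norm i (O i) (C i) (Δ i.val / 2) (by linarith [hpos i.val hi.2.1]) (hC i hi.2.1) Ψ hn1
  have key := var_abs (WithLp.toLp 2 Ψ) hψ a hcov _ _ hr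
  rw [← hsum, inner_dot, ← nsq_norm] at key
  have h4 : ∀ m, (∑ i ∈ S m, Δ i.val) ^ 2 = 4 * (∑ i ∈ S m, Δ i.val / 2) ^ 2 := by
    intro m; rw [← Finset.sum_div]; ring
  change _ ≤ ∑ m, (∑ i ∈ S m, Δ i.val) ^ 2
  simp_rw [h4]
  rw [← Finset.mul_sum]
  linarith

/-- Theorem 2, Upper Bound of QFI for partial perturbation: only the
first `N_B ≤ N` particles carry Hermitian local operators, with spectral widths
`Δ_1 ≥ ⋯ ≥ Δ_{N_B} > 0` in descending order, and `O_B = Σ_{i<N_B} Õ_i`. If the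
density matrix `ρ = Σ_l p_l |e_l⟩⟨e_l| = Σ_ν q_ν |Ψ_ν⟩⟨Ψ_ν|` is `k`-producible
for some `k ≤ N_B`, then `F_Q[ρ, O_B] ≤ F_B(k;{Δ_i})`. -/
theorem stmt9 {N : ℕ} (hN : 1 ≤ N) (NB : ℕ) (hNB : NB ≤ N) {d : Fin N → ℕ}
    (O : ∀ i, Matrix (Fin (d i)) (Fin (d i)) ℂ)
    (hO : ∀ i : Fin N, i.val < NB → (O i).IsHermitian)
    (lo hi : Fin N → ℝ)
    (hhi : ∀ i : Fin N, i.val < NB → IsGreatest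
      {μ : ℝ | ∃ v : Fin (d i) → ℂ, v ≠ 0 ∧ (O i).mulVec v = (μ : ℂ) • v} (hi i))
    (hlo : ∀ i : Fin N, i.val < NB → IsLeast
      {μ : ℝ | ∃ v : Fin (d i) → ℂ, v ≠ 0 ∧ (O i).mulVec v = (μ : ℂ) • v} (lo i))
    (Δ : ℕ → ℝ) (hΔ : ∀ i : Fin N, i.val < NB → Δ i.val = hi i - lo i)
    (hpos : ∀ n, n < NB → 0 < Δ n)
    (hdesc : ∀ m n : ℕ, m ≤ n → n < NB → Δ n ≤ Δ m)
    (k : ℕ) (hk : 1 ≤ k) (hkNB : k ≤ NB)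
    (p : (∀ i, Fin (d i)) → ℝ) (e : (∀ i, Fin (d i)) → (∀ i, Fin (d i)) → ℂ)
    (horth : ∀ x y, star (e x) ⬝ᵥ e y = if x = y then 1 else 0)
    (hp : ∀ x, 0 ≤ p x) (hpsum : ∑ x, p x = 1)
    (K : ℕ) (q : Fin K → ℝ) (Ψ : Fin K → (∀ i, Fin (d i)) → ℂ)
    (hq : ∀ ν, 0 ≤ q ν) (hqsum : ∑ ν, q ν = 1)
    (hΨunit : ∀ ν, star (Ψ ν) ⬝ᵥ Ψ ν = 1)
    (hprodu : ∀ ν, Producible d k (Ψ ν))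
    (hρ : ∑ x, (p x : ℂ) • Matrix.vecMulVec (e x) (star (e x))
        = ∑ ν, (q ν : ℂ) • Matrix.vecMulVec (Ψ ν) (star (Ψ ν))) :
    QFI p e (∑ i ∈ Finset.univ.filter (fun i : Fin N => i.val < NB), localOp i (O i))
      ≤ Fbound NB k Δ := by
  have hC : ∀ i : Fin N, i.val < NB → ∀ v,
      nsq ((O i - (((hi i + lo i) / 2 : ℝ) : ℂ) • 1) *ᵥ v) ≤ (Δ i.val / 2) ^ 2 * nsq v := by
    intro i h v
    rw [hΔ i h]
    exact spec_bound (O i) (hO i h) (lo i) (hi i) (hhi i h) (hlo i h) v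
  have hherm : (∑ i ∈ Finset.univ.filter (fun i : Fin N => i.val < NB), localOp i (O i)).IsHermitian := by
    unfold Matrix.IsHermitian
    rw [conjTranspose_sum]
    refine Finset.sum_congr rfl fun i h => ?_
    exact localOp_herm i _ (hO i (Finset.mem_filter.1 h).2)
  have hn1 : ∀ ν, nsq (Ψ ν) = 1 := by
    intro ν
    apply Complex.ofReal_injective; rw [nsq_eq, hΨunit]; simp
  unfold QFI
  refine (conv_gen p hp e horth _ hherm q hq Ψ hn1 hρ).trans ?_
  calc _ ≤ ∑ ν, q ν * Fbound NB k Δ := by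
        refine Finset.sum_le_sum fun ν _ => mul_le_mul_of_nonneg_left ?_ (hq ν)
        obtain ⟨M, c, hc, φ, hφ⟩ := hprodu ν
        exact (var_bound NB O _ Δ hpos hC c (Ψ ν) φ hφ (hΨunit ν)).trans
          (comb_bound NB Δ hpos hdesc k hk M c hc)
    _ = _ := by rw [← Finset.sum_mul, hqsum, one_mul]
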